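/- Let Ω ⊂ ℝⁿ be a convex body with inradius r and form body Ω_*, and let t ≥ 0. Then the surface area of the Minkowski sum Ω + t·Ω_* satisfies |∂(Ω + t·Ω_*)| ≤ (1 + t/r)^{n−1} · |∂Ω|. -/

import Mathlib

open Metric MeasureTheory Set
open scoped ENNReal RealInnerProductSpace Pointwise

noncomputable section

variable {n : ℕ}

/-- The inner parallel set `Ω_t = {x ∈ Ω : dist(x, Ωᶜ) ≥ t}`. -/
def innerParallel (Ω : Set (EuclideanSpace ℝ (Fin n))) (t : ℝ) :
    Set (EuclideanSpace ℝ (Fin n)) :=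
  {x ∈ Ω | t ≤ infDist x Ωᶜ}

/-- The inradius: the radius of the largest closed ball contained in `Ω`. -/
def inradius (Ω : Set (EuclideanSpace ℝ (Fin n))) : ℝ :=
  sSup {ρ : ℝ | ∃ x, closedBall x ρ ⊆ Ω}

/-- The Minkowski difference `K ∼ L = {x : x + L ⊆ K}`. -/
def minkDiff (K L : Set (EuclideanSpace ℝ (Fin n))) : Set (EuclideanSpace ℝ (Fin n)) :=
  {x | ∀ y ∈ L, x + y ∈ K}

/-- The support function `h(Ω, u) = sup_{x ∈ Ω} ⟪x, u⟫`. -/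
def supportFn (Ω : Set (EuclideanSpace ℝ (Fin n))) (u : EuclideanSpace ℝ (Fin n)) : ℝ :=
  sSup ((fun x => ⟪x, u⟫) '' Ω)

/-- `u` is an outward unit normal of a supporting hyperplane of `Ω` at `x`. -/
def IsOuterNormalAt (Ω : Set (EuclideanSpace ℝ (Fin n)))
    (x u : EuclideanSpace ℝ (Fin n)) : Prop :=
  ‖u‖ = 1 ∧ ∀ y ∈ Ω, ⟪y, u⟫ ≤ ⟪x, u⟫

/-- `regn Ω`: outward unit normals at regular boundary points (points with a unique
supporting hyperplane, i.e. a unique outward unit normal). -/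
def regn (Ω : Set (EuclideanSpace ℝ (Fin n))) : Set (EuclideanSpace ℝ (Fin n)) :=
  {u | ∃ x ∈ frontier Ω, IsOuterNormalAt Ω x u ∧ ∀ v, IsOuterNormalAt Ω x v → v = u}

/-- The form body `Ω_* = ⋂_{u ∈ regn Ω} {x : ⟪x, u⟫ ≤ 1}`. -/
def formBody (Ω : Set (EuclideanSpace ℝ (Fin n))) : Set (EuclideanSpace ℝ (Fin n)) :=
  ⋂ u ∈ regn Ω, {x | ⟪x, u⟫ ≤ 1}

/-- The width `ω = inf {h(Ω,u) + h(Ω,−u) : u ∈ S^{n−1}}`. -/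
def width (Ω : Set (EuclideanSpace ℝ (Fin n))) : ℝ :=
  sInf ((fun u => supportFn Ω u + supportFn Ω (-u)) '' sphere (0 : EuclideanSpace ℝ (Fin n)) 1)

/-- A convex set with nonempty interior has an outward unit normal at every boundary point. -/
lemma exists_isOuterNormalAt_closure {K : Set (EuclideanSpace ℝ (Fin n))} (hK : Convex ℝ K)
    (hint : (interior K).Nonempty) {p : EuclideanSpace ℝ (Fin n)} (hp : p ∈ frontier K) :
    ∃ v, IsOuterNormalAt (closure K) p v := by
  obtain ⟨f, hf⟩ := geometric_hahn_banach_open_point hK.interior isOpen_interior hp.2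
  obtain ⟨w, hw⟩ := (InnerProductSpace.toDual ℝ (EuclideanSpace ℝ (Fin n))).surjective f
  have hfw : ∀ x, f x = ⟪x, w⟫ := fun x => by
    rw [← hw, InnerProductSpace.toDual_apply_apply, real_inner_comm]
  simp only [hfw] at hf
  have hw0 : w ≠ 0 := by
    rintro rfl
    obtain ⟨a, ha⟩ := hint
    simpa using hf a ha
  have hle : closure K ⊆ {y | ⟪y, w⟫ ≤ ⟪p, w⟫} := by
    rw [← hK.closure_interior_eq_closure_of_nonempty_interior hint]
    exact closure_minimal (fun y hy => (hf y hy).le)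
      (isClosed_le (by fun_prop) continuous_const)
  refine ⟨‖w‖⁻¹ • w, by simp [norm_smul, hw0], fun y hy => ?_⟩
  simp only [inner_smul_right]
  exact mul_le_mul_of_nonneg_left (hle hy) (by positivity)

/-- Surface area is monotone under inclusion of convex sets. -/
lemma hausdorffMeasure_frontier_mono {K L : Set (EuclideanSpace ℝ (Fin n))} (hK : Convex ℝ K)
    (hint : (interior K).Nonempty) (hL : IsCompact L) (hKL : K ⊆ L) {d : ℝ} (hd : 0 ≤ d) :
    μH[d] (frontier K) ≤ μH[d] (frontier L) := by
  have key : ∀ p : frontier K, ∃ q ∈ frontier L, ∀ y ∈ closure K,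
      0 ≤ ⟪q - p.1, p.1 - y⟫ := by
    rintro ⟨p, hp⟩
    obtain ⟨v, hv, hle⟩ := exists_isOuterNormalAt_closure hK hint hp
    have hpL : p ∈ L := closure_minimal hKL hL.isClosed hp.1
    obtain ⟨R, hR⟩ := hL.isBounded.subset_ball p
    have hout : p + (max R 0) • v ∉ L := fun h => by
      have := hR h
      simp only [mem_ball, dist_self_add_left, norm_smul, hv, mul_one, Real.norm_eq_abs] at this
      exact absurd ((le_max_left R 0).trans (le_abs_self _)) this.not_ge
    have hconn : IsPreconnected ((fun s : ℝ => p + s • v) '' Ici 0) :=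
      isPreconnected_Ici.image _ (by fun_prop)
    have hpray : p ∈ (fun s : ℝ => p + s • v) '' Ici 0 := ⟨0, by simp, by simp⟩
    obtain ⟨q, ⟨s, hs, rfl⟩, hq⟩ : ∃ q ∈ (fun s : ℝ => p + s • v) '' Ici 0, q ∈ frontier L := by
      by_contra! hno
      have hmem : ∀ q ∈ (fun s : ℝ => p + s • v) '' Ici 0, q ∈ L → q ∈ interior L :=
        fun q hq hqL => by_contra fun hqi => hno q hq ⟨subset_closure hqL, hqi⟩
      obtain ⟨q, -, hq, hq'⟩ := hconn (interior L) Lᶜ isOpen_interior hL.isClosed.isOpen_compl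
        (fun q hq => or_iff_not_imp_right.2 fun hqL => hmem q hq (not_not.1 hqL))
        ⟨p, hpray, hmem p hpray hpL⟩ ⟨_, ⟨max R 0, mem_Ici.2 (le_max_right _ _), rfl⟩, hout⟩
      exact hq' (interior_subset hq)
    refine ⟨_, hq, fun y hy => ?_⟩
    have := hle y hy
    simp only [add_sub_cancel_left, inner_smul_left, inner_sub_right, conj_trivial]
    rw [real_inner_comm p v, real_inner_comm y v, ← mul_sub]
    exact mul_nonneg (mem_Ici.1 hs) (sub_nonneg.2 this)
  choose g hgL hg using key
  have hanti : AntilipschitzWith 1 g := AntilipschitzWith.of_le_mul_dist fun a b => by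
    have ha := hg a b b.2.1
    have hb := hg b a a.2.1
    have hinner : ‖a.1 - b.1‖ * ‖a.1 - b.1‖ ≤ ‖g a - g b‖ * ‖a.1 - b.1‖ := by
      refine le_trans ?_ (real_inner_le_norm _ _)
      rw [← real_inner_self_eq_norm_mul_norm]
      simp only [inner_sub_left, inner_sub_right] at ha hb ⊢
      linarith
    rw [Subtype.dist_eq, dist_eq_norm, dist_eq_norm, NNReal.coe_one, one_mul]
    rcases (norm_nonneg (a.1 - b.1)).eq_or_lt with h | h
    · rw [← h]; positivity
    · exact le_of_mul_le_mul_right hinner h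
  calc μH[d] (frontier K) = μH[d] (univ : Set (frontier K)) := by
        rw [← Isometry.hausdorffMeasure_image (f := ((↑) : frontier K → EuclideanSpace ℝ (Fin n)))
          isometry_subtype_coe (Or.inl hd), image_univ,
          Subtype.range_coe]
    _ ≤ μH[d] (g '' univ) := by simpa using hanti.le_hausdorffMeasure_image hd univ
    _ ≤ μH[d] (frontier L) := measure_mono (by rintro _ ⟨a, -, rfl⟩; exact hgL a)

/-- If a closed ball of radius `ρ > 0` contained in `Ω` touches the boundary of `Ω` at `p`, then
`p` is a regular point, with normal pointing from the centre of the ball to `p`. -/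
lemma mem_regn_of_closedBall_subset {Ω : Set (EuclideanSpace ℝ (Fin n))} (hΩ : Convex ℝ Ω)
    {z u : EuclideanSpace ℝ (Fin n)} {ρ : ℝ} (hρ : 0 < ρ) (hball : closedBall z ρ ⊆ Ω)
    (hu : ‖u‖ = 1) (hp : z + ρ • u ∈ frontier Ω) :
    u ∈ regn Ω ∧ ∀ y ∈ Ω, ⟪y, u⟫ ≤ ⟪z, u⟫ + ρ := by
  have huniq : ∀ v, IsOuterNormalAt Ω (z + ρ • u) v → v = u := by
    rintro v ⟨hv, hle⟩
    have h := hle (z + ρ • v) (hball (by simp [norm_smul, hv, abs_of_pos hρ]))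
    simp only [inner_add_left, inner_smul_left, conj_trivial, real_inner_self_eq_norm_sq, hv,
      one_pow, mul_one] at h
    have h1 : 1 ≤ ⟪u, v⟫ := by
      by_contra! hlt
      nlinarith
    have h2 : ⟪u, v⟫ ≤ 1 := by simpa [hu, hv] using real_inner_le_norm u v
    exact ((inner_eq_one_iff_of_norm_eq_one hu hv).1 (le_antisymm h2 h1)).symm
  have hint : (interior Ω).Nonempty :=
    ⟨z, interior_mono hball (ball_subset_interior_closedBall (mem_ball_self hρ))⟩
  obtain ⟨v, hv, hle⟩ := exists_isOuterNormalAt_closure hΩ hint hp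
  have hv' : IsOuterNormalAt Ω (z + ρ • u) v := ⟨hv, fun y hy => hle y (subset_closure hy)⟩
  obtain rfl := huniq v hv'
  refine ⟨⟨_, hp, hv', huniq⟩, fun y hy => ?_⟩
  simpa [inner_add_left, inner_smul_left, hv] using hv'.2 y hy

/-- A convex body is the intersection of its supporting half-spaces at regular points. -/
lemma exists_mem_regn_forall_inner_lt {Ω : Set (EuclideanSpace ℝ (Fin n))}
    (hcl : IsClosed Ω) (hΩ : Convex ℝ Ω) (hint : (interior Ω).Nonempty)
    {x : EuclideanSpace ℝ (Fin n)} (hx : x ∉ Ω) :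
    ∃ u ∈ regn Ω, ∀ y ∈ Ω, ⟪y, u⟫ < ⟪x, u⟫ := by
  obtain ⟨z, hz⟩ := hint
  obtain ⟨δ, hδ, hzδ⟩ := Metric.isOpen_iff.1 isOpen_interior z hz
  replace hzδ : ball z δ ⊆ Ω := hzδ.trans interior_subset
  have hne : (Ωᶜ).Nonempty := ⟨x, hx⟩
  -- Shrink a ball around `z` linearly to the point `x`, and stop when it touches the boundary.
  set c : ℝ → EuclideanSpace ℝ (Fin n) := fun s => z + s • (x - z) with hc
  have hcont : Continuous c := by fun_prop
  obtain ⟨s₁, hs₁, hcs₁⟩ : ∃ s ∈ Ico (0 : ℝ) 1, c s ∉ Ω := by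
    have hopen : c ⁻¹' Ωᶜ ∈ nhds (1 : ℝ) :=
      (hcl.isOpen_compl.preimage hcont).mem_nhds (by simpa [hc] using hx)
    have h := Filter.inter_mem (mem_nhdsWithin_of_mem_nhds hopen)
      (Ico_mem_nhdsLT (zero_lt_one' ℝ))
    obtain ⟨s, hs, hs'⟩ := Filter.nonempty_of_mem h
    exact ⟨s, hs', hs⟩
  have hz0 : δ ≤ infDist z Ωᶜ := (le_infDist hne).2 fun y hy => by
    by_contra! hlt
    exact hy (hzδ (mem_ball'.2 hlt))
  obtain ⟨s, hs, hgs⟩ : ∃ s ∈ Icc 0 s₁, infDist (c s) Ωᶜ - (1 - s) * (δ / 2) = 0 := by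
    refine intermediate_value_Icc' hs₁.1
      (f := fun s => infDist (c s) Ωᶜ - (1 - s) * (δ / 2)) (Continuous.continuousOn ?_) ⟨?_, ?_⟩
    · exact ((continuous_infDist_pt _).comp hcont).sub (by fun_prop)
    · simp only [infDist_zero_of_mem (show c s₁ ∈ Ωᶜ from hcs₁)]
      nlinarith [hs₁.2]
    · simp only [hc, zero_smul, add_zero]
      linarith
  have hs1 : s < 1 := hs.2.trans_lt hs₁.2
  set ρ := (1 - s) * (δ / 2) with hρdef
  have hρ : 0 < ρ := mul_pos (by linarith) (by linarith)
  have hinf : infDist (c s) Ωᶜ = ρ := by linarith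
  have hball : closedBall (c s) ρ ⊆ Ω := by
    rw [← closure_ball _ hρ.ne', ← hinf]
    exact closure_minimal ball_infDist_compl_subset hcl
  obtain ⟨p, hp, hdist⟩ := exists_mem_closure_infDist_eq_dist hne (c s)
  have hpn : ‖p - c s‖ = ρ := by rw [← dist_eq_norm, dist_comm, ← hdist, hinf]
  have hpu : c s + ρ • (ρ⁻¹ • (p - c s)) = p := by
    rw [smul_inv_smul₀ hρ.ne']; abel
  have hu : ‖ρ⁻¹ • (p - c s)‖ = 1 := by
    rw [norm_smul, hpn, norm_inv, Real.norm_of_nonneg hρ.le, inv_mul_cancel₀ hρ.ne']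
  set u := ρ⁻¹ • (p - c s)
  have hpΩ : p ∈ Ω := hball (by rw [mem_closedBall, dist_eq_norm, hpn])
  have hpf : c s + ρ • u ∈ frontier Ω := by
    rw [hpu, frontier_eq_closure_inter_closure]
    exact ⟨subset_closure hpΩ, hp⟩
  obtain ⟨hur, hle⟩ := mem_regn_of_closedBall_subset hΩ hρ hball hu hpf
  refine ⟨u, hur, fun y hy => (hle y hy).trans_lt ?_⟩
  have h := hle (z + (3 * δ / 4) • u) (hzδ (by
    rw [mem_ball, dist_eq_norm, add_sub_cancel_left, norm_smul, hu, Real.norm_of_nonneg] <;>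
    linarith))
  simp only [hc, inner_add_left, inner_smul_left, inner_sub_left, conj_trivial,
    real_inner_self_eq_norm_sq, hu] at h ⊢
  have hs0 : 0 ≤ s := hs.1
  have ha : δ / 2 < ⟪x, u⟫ - ⟪z, u⟫ := by
    by_contra! hcon
    nlinarith
  nlinarith

/-- The supremum defining the inradius of a convex body is attained, and positive. -/
lemma exists_closedBall_inradius_subset [NeZero n] {Ω : Set (EuclideanSpace ℝ (Fin n))}
    (hcomp : IsCompact Ω) (hint : (interior Ω).Nonempty) :
    0 < inradius Ω ∧ ∃ x, closedBall x (inradius Ω) ⊆ Ω := by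
  have hne : (Ωᶜ).Nonempty := nonempty_compl.2 hcomp.ne_univ
  obtain ⟨x, -, hmax⟩ := hcomp.exists_isMaxOn (hint.mono interior_subset)
    (continuous_infDist_pt Ωᶜ).continuousOn
  have hle : ∀ y ρ, 0 ≤ ρ → closedBall y ρ ⊆ Ω → ρ ≤ infDist x Ωᶜ := fun y ρ hρ hy => by
    refine le_trans ((le_infDist hne).2 fun w hw => ?_) (hmax (hy (mem_closedBall_self hρ)))
    by_contra! hlt
    exact hw (hy (mem_closedBall'.2 hlt.le))
  have hpos : 0 < infDist x Ωᶜ := by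
    obtain ⟨z, hz⟩ := hint
    obtain ⟨δ, hδ, hzδ⟩ := Metric.nhds_basis_closedBall.mem_iff.1 (mem_interior_iff_mem_nhds.1 hz)
    exact hδ.trans_le (hle z δ hδ.le hzδ)
  have hball : closedBall x (infDist x Ωᶜ) ⊆ Ω := by
    rw [← closure_ball _ hpos.ne']
    exact closure_minimal ball_infDist_compl_subset hcomp.isClosed
  have hr : inradius Ω = infDist x Ωᶜ := by
    refine IsGreatest.csSup_eq ⟨⟨x, hball⟩, ?_⟩
    rintro ρ ⟨y, hy⟩
    rcases le_total 0 ρ with hρ | hρ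
    · exact hle y ρ hρ hy
    · exact hρ.trans hpos.le
  rw [hr]
  exact ⟨hpos, x, hball⟩

/-- If `Ω` contains a ball of radius `r` centred at `x`, then `x + r Ω_* ⊆ Ω`. -/
lemma add_smul_mem_of_mem_formBody {Ω : Set (EuclideanSpace ℝ (Fin n))}
    (hcl : IsClosed Ω) (hΩ : Convex ℝ Ω) (hint : (interior Ω).Nonempty)
    {x w : EuclideanSpace ℝ (Fin n)} {r : ℝ} (hr : 0 < r) (hball : closedBall x r ⊆ Ω)
    (hw : w ∈ formBody Ω) : x + r • w ∈ Ω := by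
  by_contra hout
  obtain ⟨u, hu, hlt⟩ := exists_mem_regn_forall_inner_lt hcl hΩ hint hout
  have hwu : ⟪w, u⟫ ≤ 1 := mem_iInter₂.1 hw u hu
  obtain ⟨-, -, ⟨hu1, -⟩, -⟩ := hu
  have h := hlt (x + r • u) (hball (by simp [norm_smul, hu1, abs_of_pos hr]))
  simp only [inner_add_left, inner_smul_left, conj_trivial, real_inner_self_eq_norm_sq, hu1] at h
  nlinarith

lemma convex_formBody (Ω : Set (EuclideanSpace ℝ (Fin n))) : Convex ℝ (formBody Ω) :=
  convex_iInter₂ fun u _ => by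
    simp_rw [real_inner_comm u]
    exact convex_halfSpace_le (innerSL ℝ u).isLinear 1

lemma zero_mem_formBody (Ω : Set (EuclideanSpace ℝ (Fin n))) : 0 ∈ formBody Ω := by
  simp [formBody]

/-- Surface area scales by at most `c ^ d` under the homothety `x ↦ c • x + b`. -/
lemma hausdorffMeasure_frontier_homothety_le (Ω : Set (EuclideanSpace ℝ (Fin n)))
    (b : EuclideanSpace ℝ (Fin n)) {c : ℝ} (hc : 0 < c) {d : ℝ} (hd : 0 ≤ d) :
    μH[d] (frontier ((fun x => c • x + b) '' Ω)) ≤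
      ENNReal.ofReal c ^ d * μH[d] (frontier Ω) := by
  have hhomeo : frontier ((fun x => c • x + b) '' Ω) = (fun x => c • x + b) '' frontier Ω :=
    (((Homeomorph.smulOfNeZero c hc.ne').trans (Homeomorph.addRight b)).image_frontier Ω).symm
  have hlip : LipschitzWith c.toNNReal (fun x : EuclideanSpace ℝ (Fin n) => c • x + b) :=
    LipschitzWith.of_dist_le_mul fun x y => by
      rw [dist_add_right, dist_smul₀, Real.coe_toNNReal _ hc.le, Real.norm_of_nonneg hc.le]
  rw [hhomeo]
  exact hlip.hausdorffMeasure_image_le hd _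

/-- For a convex body `Ω` with inradius `r` and `t ≥ 0`,
`|∂(Ω + t Ω_*)| ≤ (1 + t/r)^{n−1} |∂Ω|`. -/
theorem perimeter_add_smul_formBody_le
    (Ω : Set (EuclideanSpace ℝ (Fin n))) (hcomp : IsCompact Ω) (hconv : Convex ℝ Ω)
    (hint : (interior Ω).Nonempty) (r t : ℝ) (hr : r = inradius Ω) (ht : 0 ≤ t) :
    μH[(n : ℝ) - 1] (frontier (Ω + t • formBody Ω)) ≤
      ENNReal.ofReal ((1 + t / r) ^ (n - 1)) * μH[(n : ℝ) - 1] (frontier Ω) := by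
  rcases Nat.eq_zero_or_pos n with rfl | hn
  · simp
  have : NeZero n := ⟨hn.ne'⟩
  have hd : (0 : ℝ) ≤ (n : ℝ) - 1 := sub_nonneg.2 (by exact_mod_cast hn)
  obtain ⟨hr0, x, hball⟩ := exists_closedBall_inradius_subset hcomp hint
  rw [← hr] at hr0 hball
  have hc : 0 < 1 + t / r := by positivity
  have hsub : Ω + t • formBody Ω ⊆ (fun y => (1 + t / r) • y + (-(t / r)) • x) '' Ω := by
    rintro _ ⟨y, hy, _, ⟨w, hw, rfl⟩, rfl⟩
    have hw' := add_smul_mem_of_mem_formBody hcomp.isClosed hconv hint hr0 hball hw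
    refine ⟨(1 + t / r)⁻¹ • y + ((1 + t / r)⁻¹ * (t / r)) • (x + r • w),
      hconv hy hw' (by positivity) (by positivity) (by field_simp), ?_⟩
    simp only [smul_add, smul_smul, ← mul_assoc, mul_inv_cancel₀ hc.ne', one_mul, one_smul,
      div_mul_cancel₀ t hr0.ne']
    module
  have hint' : (interior (Ω + t • formBody Ω)).Nonempty :=
    hint.mono (interior_mono fun y hy =>
      ⟨y, hy, 0, ⟨0, zero_mem_formBody Ω, smul_zero t⟩, add_zero y⟩)
  calc μH[(n : ℝ) - 1] (frontier (Ω + t • formBody Ω))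
      ≤ μH[(n : ℝ) - 1] (frontier ((fun y => (1 + t / r) • y + (-(t / r)) • x) '' Ω)) :=
        hausdorffMeasure_frontier_mono (hconv.add ((convex_formBody Ω).smul t)) hint'
          (hcomp.image (by fun_prop)) hsub hd
    _ ≤ ENNReal.ofReal (1 + t / r) ^ ((n : ℝ) - 1) * μH[(n : ℝ) - 1] (frontier Ω) :=
        hausdorffMeasure_frontier_homothety_le Ω _ hc hd
    _ = ENNReal.ofReal ((1 + t / r) ^ (n - 1)) * μH[(n : ℝ) - 1] (frontier Ω) := by
        rw [ENNReal.ofReal_pow hc.le, ← ENNReal.rpow_natCast, Nat.cast_pred hn]
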